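/- Let d ≥ 2 and n ≥ 1, let μ be a partition of n into at most d parts with μ₂ ≥ 1, and set N := binom(n,μ). Then the achievable hypothesis-testing region, i.e. the set of pairs (α, β) = (1 − Tr[Π ρ_=^n], Tr[Π ρ_≠^μ]) ranging over all Hermitian Π with 0 ⪯ Π ⪯ I, is exactly the parallelogram { (α, β) ∈ [0,1]² : (1−α)/N ≤ β ≤ 1 − α/N }. In particular the lower boundary β = (1−α)/N is achieved by Π = (1−α)·Π_{(n)}, and the upper boundary β = 1 − α/N is achieved by Π = (1−α)·Π_{(n)} + (I − Π_{(n)}). -/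

import Mathlib

open MeasureTheory Matrix
open scoped ComplexOrder

noncomputable section

/-- The unitary group `U(d)`. -/
abbrev UG (d : ℕ) := Matrix.unitaryGroup (Fin d) ℂ

noncomputable instance (d : ℕ) : MeasurableSpace (UG d) := borel _

instance (d : ℕ) : BorelSpace (UG d) := ⟨rfl⟩

/-- The permutation matrix `ψ(π)` on `(ℂ^d)^{⊗n}`, with `(x,y)` entry `1` iff `y = x ∘ π`. -/
def psi (d n : ℕ) (π : Equiv.Perm (Fin n)) : Matrix (Fin n → Fin d) (Fin n → Fin d) ℂ :=
  Matrix.of fun x y => if y = x ∘ π then 1 else 0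

/-- The symmetrizer `Π_{(n)} = (1/n!) ∑_{π ∈ S_n} ψ(π)`. -/
def symmetrizer (d n : ℕ) : Matrix (Fin n → Fin d) (Fin n → Fin d) ℂ :=
  ((n.factorial : ℂ))⁻¹ • ∑ π : Equiv.Perm (Fin n), psi d n π

/-- The `n`-fold tensor power of a `d × d` matrix: `(U^{⊗n})_{x,y} = ∏ i, U_{x i, y i}`. -/
def tpow (d n : ℕ) (U : Matrix (Fin d) (Fin d) ℂ) :
    Matrix (Fin n → Fin d) (Fin n → Fin d) ℂ :=
  Matrix.of fun x y => ∏ i, U (x i) (y i)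

/-- The list consisting of `μ 0` copies of `0`, then `μ 1` copies of `1`, etc. -/
def wordList (d : ℕ) (μ : Fin d → ℕ) : List (Fin d) :=
  (List.ofFn fun i => List.replicate (μ i) i).flatten

lemma wordList_length (d : ℕ) (μ : Fin d → ℕ) : (wordList d μ).length = ∑ i, μ i := by
  simp [wordList, List.length_flatten, Function.comp, List.sum_ofFn]

/-- The word indexing the basis vector `|e_μ⟩`: the first `μ 0` tensor factors carry the
first basis label, the next `μ 1` factors the second basis label, etc. -/
def word (d n : ℕ) (μ : Fin d → ℕ) (hsum : ∑ i, μ i = n) (j : Fin n) : Fin d :=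
  (wordList d μ).get ⟨j, by rw [wordList_length, hsum]; exact j.isLt⟩

/-- `∫ U^{⊗n} |e_w⟩⟨e_w| (U^{⊗n})^† dq` for a basis word `w` (entrywise Bochner integral). -/
def rhoWord (d n : ℕ) (w : Fin n → Fin d) (q : Measure (UG d)) :
    Matrix (Fin n → Fin d) (Fin n → Fin d) ℂ :=
  Matrix.of fun x y =>
    ∫ U : UG d, tpow d n (U : Matrix (Fin d) (Fin d) ℂ) x w *
      star (tpow d n (U : Matrix (Fin d) (Fin d) ℂ) y w) ∂q

/-- The Haar-twirled unequal state `ρ_≠^μ`. -/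
def rhoNE (d n : ℕ) (μ : Fin d → ℕ) (hsum : ∑ i, μ i = n) (haar : Measure (UG d)) :
    Matrix (Fin n → Fin d) (Fin n → Fin d) ℂ :=
  rhoWord d n (word d n μ hsum) haar

/-- The partition `(n, 0, …, 0)`. -/
def muEq (d n : ℕ) (hd : 0 < d) : Fin d → ℕ := fun i => if i = ⟨0, hd⟩ then n else 0

lemma muEq_sum (d n : ℕ) (hd : 0 < d) : ∑ i, muEq d n hd i = n := by
  simp [muEq]

/-- The equal state `ρ_=^n = ρ_≠^{(n,0,…,0)}`. -/
def rhoEQ (d n : ℕ) (hd : 0 < d) (haar : Measure (UG d)) :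
    Matrix (Fin n → Fin d) (Fin n → Fin d) ℂ :=
  rhoNE d n (muEq d n hd) (muEq_sum d n hd) haar

/-- The set of POVM elements: Hermitian `P` with `0 ⪯ P ⪯ I`. -/
def POVMs (d n : ℕ) : Set (Matrix (Fin n → Fin d) (Fin n → Fin d) ℂ) :=
  {P | P.PosSemidef ∧ (1 - P).PosSemidef}

/-- The average success probability of the test `{P, I - P}` with prior `p` on the equal case. -/
def successProb (d n : ℕ) (hd : 0 < d) (μ : Fin d → ℕ) (hsum : ∑ i, μ i = n)
    (haar : Measure (UG d)) (p : ℝ) (P : Matrix (Fin n → Fin d) (Fin n → Fin d) ℂ) : ℝ :=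
  p * (Matrix.trace (P * rhoEQ d n hd haar)).re +
    (1 - p) * (1 - (Matrix.trace (P * rhoNE d n μ hsum haar)).re)

lemma tpow_mul' (d n : ℕ) (A B : Matrix (Fin d) (Fin d) ℂ) :
    tpow d n (A * B) = tpow d n A * tpow d n B := by
  ext x y
  simp only [tpow, Matrix.of_apply, Matrix.mul_apply, Fintype.prod_sum, Finset.prod_mul_distrib]

lemma tpow_diag (d n : ℕ) (v : Fin d → ℂ) :
    tpow d n (Matrix.diagonal v) = Matrix.diagonal (fun x => ∏ i, v (x i)) := by
  ext x y
  simp only [tpow, Matrix.of_apply, Matrix.diagonal_apply]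
  split_ifs with h
  · subst h; simp
  · obtain ⟨i, hi⟩ := Function.ne_iff.mp h
    exact Finset.prod_eq_zero (Finset.mem_univ i) (by simp [hi])

lemma tpow_one' (d n : ℕ) : tpow d n 1 = 1 := by
  rw [← Matrix.diagonal_one, tpow_diag]; simp

lemma tpow_ct (d n : ℕ) (A : Matrix (Fin d) (Fin d) ℂ) :
    tpow d n Aᴴ = (tpow d n A)ᴴ := by
  ext x y
  simp [tpow, Matrix.conjTranspose_apply]

lemma tpow_unit (d n : ℕ) (U : UG d) :
    (tpow d n (U : Matrix (Fin d) (Fin d) ℂ))ᴴ * tpow d n (U : Matrix (Fin d) (Fin d) ℂ) = 1 := by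
  rw [← tpow_ct, ← tpow_mul', ← Matrix.star_eq_conjTranspose,
    Matrix.UnitaryGroup.star_mul_self, tpow_one']

lemma tpow_comp (d n : ℕ) (A : Matrix (Fin d) (Fin d) ℂ) (x y : Fin n → Fin d)
    (π : Equiv.Perm (Fin n)) : tpow d n A (x ∘ π) (y ∘ π) = tpow d n A x y := by
  simp only [tpow, Matrix.of_apply, Function.comp]
  exact Equiv.prod_comp π (fun i => A (x i) (y i))

lemma tpow_norm (d n : ℕ) (U : UG d) (x y : Fin n → Fin d) :
    ‖tpow d n (U : Matrix (Fin d) (Fin d) ℂ) x y‖ ≤ 1 := by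
  simp only [tpow, Matrix.of_apply, norm_prod]
  exact Finset.prod_le_one (fun _ _ => norm_nonneg _)
    (fun i _ => entry_norm_bound_of_unitary U.2 _ _)

lemma tpow_cont (d n : ℕ) (x y : Fin n → Fin d) :
    Continuous fun U : UG d => tpow d n (U : Matrix (Fin d) (Fin d) ℂ) x y := by
  simp only [tpow, Matrix.of_apply]
  refine continuous_finsetProd _ fun i _ => ?_
  exact (continuous_subtype_val (p := fun M => M ∈ Matrix.unitaryGroup (Fin d) ℂ)).matrix_elem _ _

lemma tt_int (d n : ℕ) (haar : Measure (UG d)) [IsProbabilityMeasure haar]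
    (x y w w' : Fin n → Fin d) :
    Integrable (fun U : UG d => tpow d n (U : Matrix (Fin d) (Fin d) ℂ) x w *
      star (tpow d n (U : Matrix (Fin d) (Fin d) ℂ) y w')) haar := by
  refine Integrable.of_bound (C := 1) ?_ (Filter.Eventually.of_forall fun U => ?_)
  · exact ((tpow_cont d n x w).mul (tpow_cont d n y w').star).aestronglyMeasurable
  · rw [norm_mul, norm_star]
    exact mul_le_one₀ (tpow_norm ..) (norm_nonneg _) (tpow_norm ..)

lemma rho_conj (d n : ℕ) (haar : Measure (UG d)) [IsProbabilityMeasure haar]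
    (hinv : ∀ V : UG d, Measure.map (fun U => V * U) haar = haar) (w : Fin n → Fin d) (V : UG d) :
    rhoWord d n w haar = tpow d n (V : Matrix (Fin d) (Fin d) ℂ) * rhoWord d n w haar *
      (tpow d n (V : Matrix (Fin d) (Fin d) ℂ))ᴴ := by
  ext x y
  have h1 : rhoWord d n w haar x y = ∫ U : UG d,
      tpow d n ((V * U : UG d) : Matrix (Fin d) (Fin d) ℂ) x w *
      star (tpow d n ((V * U : UG d) : Matrix (Fin d) (Fin d) ℂ) y w) ∂haar := by
    conv_lhs => rw [← hinv V]
    simp only [rhoWord, Matrix.of_apply]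
    rw [integral_map]
    · exact (continuous_const.mul continuous_id).measurable.aemeasurable
    · exact ((tpow_cont d n x w).mul (tpow_cont d n y w).star).aestronglyMeasurable
  rw [h1]
  have h2 : ∀ U : UG d, tpow d n ((V * U : UG d) : Matrix (Fin d) (Fin d) ℂ) x w *
      star (tpow d n ((V * U : UG d) : Matrix (Fin d) (Fin d) ℂ) y w) =
      ∑ b, ∑ a, tpow d n (V : Matrix (Fin d) (Fin d) ℂ) x a *
        (tpow d n (U : Matrix (Fin d) (Fin d) ℂ) a w *
          star (tpow d n (U : Matrix (Fin d) (Fin d) ℂ) b w)) *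
        star (tpow d n (V : Matrix (Fin d) (Fin d) ℂ) y b) := by
    intro U
    rw [Matrix.UnitaryGroup.mul_val, tpow_mul']
    simp only [Matrix.mul_apply, star_sum, star_mul', Finset.sum_mul_sum]
    rw [Finset.sum_comm]
    refine Finset.sum_congr rfl fun b _ => Finset.sum_congr rfl fun a _ => ?_
    ring
  simp only [h2]
  rw [integral_finsetSum]
  swap
  · intro b _
    refine integrable_finsetSum _ fun a _ => ?_
    exact ((tt_int d n haar a b w w).const_mul _).mul_const _
  simp only [Matrix.mul_apply, Finset.sum_mul, Matrix.conjTranspose_apply]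
  refine Finset.sum_congr rfl fun b _ => ?_
  rw [integral_finsetSum]
  swap
  · intro a _
    exact ((tt_int d n haar a b w w).const_mul _).mul_const _
  refine Finset.sum_congr rfl fun a _ => ?_
  rw [integral_mul_const, integral_const_mul]
  rfl

lemma rho_comm (d n : ℕ) (haar : Measure (UG d)) [IsProbabilityMeasure haar]
    (hinv : ∀ V : UG d, Measure.map (fun U => V * U) haar = haar) (w : Fin n → Fin d) (V : UG d) :
    rhoWord d n w haar * tpow d n (V : Matrix (Fin d) (Fin d) ℂ) =
      tpow d n (V : Matrix (Fin d) (Fin d) ℂ) * rhoWord d n w haar := by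
  conv_lhs => rw [rho_conj d n haar hinv w V]
  rw [Matrix.mul_assoc, tpow_unit, Matrix.mul_one]

lemma rho_herm (d n : ℕ) (haar : Measure (UG d)) (w : Fin n → Fin d) :
    (rhoWord d n w haar)ᴴ = rhoWord d n w haar := by
  ext x y
  simp only [rhoWord, Matrix.conjTranspose_apply, Matrix.of_apply]
  rw [← starRingEnd_apply, ← integral_conj]
  congr 1
  ext U
  simp [mul_comm]

lemma rho_trace_nonneg (d n : ℕ) (haar : Measure (UG d)) [IsProbabilityMeasure haar]
    (w : Fin n → Fin d) (P : Matrix (Fin n → Fin d) (Fin n → Fin d) ℂ) (hP : P.PosSemidef) :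
    0 ≤ (Matrix.trace (P * rhoWord d n w haar)).re := by
  have h : Matrix.trace (P * rhoWord d n w haar) =
      ∫ U : UG d, (star (fun x => tpow d n (U : Matrix (Fin d) (Fin d) ℂ) x w) ⬝ᵥ
        P *ᵥ (fun x => tpow d n (U : Matrix (Fin d) (Fin d) ℂ) x w)) ∂haar := by
    have h2 : ∀ U : UG d, (star (fun x => tpow d n (U : Matrix (Fin d) (Fin d) ℂ) x w) ⬝ᵥ
        P *ᵥ (fun x => tpow d n (U : Matrix (Fin d) (Fin d) ℂ) x w)) =
        ∑ x, ∑ y, P x y * (tpow d n (U : Matrix (Fin d) (Fin d) ℂ) y w *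
          star (tpow d n (U : Matrix (Fin d) (Fin d) ℂ) x w)) := by
      intro U
      simp only [dotProduct, Matrix.mulVec, Finset.mul_sum, Pi.star_apply]
      refine Finset.sum_congr rfl fun b _ => Finset.sum_congr rfl fun a _ => ?_
      ring
    simp only [h2]
    rw [integral_finsetSum]
    swap
    · intro b _
      exact integrable_finsetSum _ fun a _ => (tt_int d n haar a b w w).const_mul _
    simp only [Matrix.trace, Matrix.diag_apply, Matrix.mul_apply]
    refine Finset.sum_congr rfl fun b _ => ?_
    rw [integral_finsetSum _ fun a _ => (tt_int d n haar a b w w).const_mul _]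
    refine Finset.sum_congr rfl fun a _ => ?_
    rw [integral_const_mul]
    rfl
  have h0 : 0 ≤ Matrix.trace (P * rhoWord d n w haar) := by
    rw [h]
    exact integral_nonneg fun U => hP.dotProduct_mulVec_nonneg _
  exact (Complex.le_def.mp h0).1

lemma rho_perm_sum (d n : ℕ) (haar : Measure (UG d)) [IsProbabilityMeasure haar]
    (w : Fin n → Fin d) (π : Equiv.Perm (Fin n)) :
    ∑ x, rhoWord d n w haar (x ∘ π) x = if w ∘ π = w then 1 else 0 := by
  simp only [rhoWord, Matrix.of_apply]
  rw [← integral_finsetSum _ fun x _ => tt_int d n haar (x ∘ π) x w w]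
  have h : ∀ U : UG d, ∑ x : Fin n → Fin d, tpow d n (U : Matrix (Fin d) (Fin d) ℂ) (x ∘ π) w *
      star (tpow d n (U : Matrix (Fin d) (Fin d) ℂ) x w) = if w ∘ π = w then 1 else 0 := by
    intro U
    have h1 := congrFun (congrFun (tpow_unit d n U) w) (w ∘ π.symm)
    rw [Matrix.mul_apply] at h1
    have h3 : (w = w ∘ π.symm) ↔ (w ∘ π = w) := by
      constructor
      · intro h; nth_rw 1 [h]; ext i; simp
      · intro h; nth_rw 2 [← h]; ext i; simp
    rw [Matrix.one_apply] at h1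
    simp only [h3] at h1
    rw [← h1]
    refine Finset.sum_congr rfl fun x _ => ?_
    rw [Matrix.conjTranspose_apply, mul_comm, ← tpow_comp d n _ x (w ∘ π.symm) π]
    congr 2
    ext i; simp
  rw [integral_congr_ae (Filter.Eventually.of_forall h)]
  simp

lemma symm_apply (d n : ℕ) (x y : Fin n → Fin d) : symmetrizer d n x y =
    ((n.factorial : ℂ))⁻¹ * ∑ π : Equiv.Perm (Fin n), if y = x ∘ π then 1 else 0 := by
  simp [symmetrizer, psi, Matrix.sum_apply]

lemma symm_mul_apply (d n : ℕ) (M : Matrix (Fin n → Fin d) (Fin n → Fin d) ℂ)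
    (x y : Fin n → Fin d) : (symmetrizer d n * M) x y =
    ((n.factorial : ℂ))⁻¹ * ∑ π : Equiv.Perm (Fin n), M (x ∘ π) y := by
  simp only [Matrix.mul_apply, symm_apply, mul_assoc, Finset.sum_mul]
  rw [← Finset.mul_sum, Finset.sum_comm]
  simp

lemma symm_left (d n : ℕ) (x y : Fin n → Fin d) (σ : Equiv.Perm (Fin n)) :
    symmetrizer d n (x ∘ σ) y = symmetrizer d n x y := by
  rw [symm_apply, symm_apply]
  congr 1
  exact Fintype.sum_equiv (Equiv.mulLeft σ) _ _ (fun π => by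
    rw [Equiv.coe_mulLeft, Equiv.Perm.coe_mul, Function.comp_assoc])

lemma fact_avg (n : ℕ) (c : ℂ) :
    ((n.factorial : ℂ))⁻¹ * ∑ _π : Equiv.Perm (Fin n), c = c := by
  have : (n.factorial : ℂ) ≠ 0 := by exact_mod_cast n.factorial_ne_zero
  simp [Fintype.card_perm, this]

lemma symm_idem (d n : ℕ) : symmetrizer d n * symmetrizer d n = symmetrizer d n := by
  ext x y
  rw [symm_mul_apply]
  simp only [symm_left, fact_avg]

lemma symm_herm (d n : ℕ) : (symmetrizer d n)ᴴ = symmetrizer d n := by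
  ext x y
  rw [Matrix.conjTranspose_apply, symm_apply, symm_apply]
  simp only [star_mul', star_sum, star_inv₀, star_natCast]
  congr 1
  refine Fintype.sum_equiv (Equiv.inv _) _ _ (fun π => ?_)
  have h3 : (x = y ∘ π) ↔ (y = x ∘ (π⁻¹ : Equiv.Perm (Fin n))) := by
    constructor
    · rintro rfl; ext i; simp
    · rintro rfl; ext i; simp
  simp only [Equiv.inv_apply, ← h3]
  split_ifs <;> simp

lemma symm_psd (d n : ℕ) : (symmetrizer d n).PosSemidef := by
  have := Matrix.posSemidef_conjTranspose_mul_self (symmetrizer d n)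
  rwa [symm_herm, symm_idem] at this

lemma cosymm_idem (d n : ℕ) :
    (1 - symmetrizer d n) * (1 - symmetrizer d n) = 1 - symmetrizer d n := by
  rw [mul_sub, sub_mul, sub_mul, symm_idem]; simp

lemma cosymm_herm (d n : ℕ) : (1 - symmetrizer d n)ᴴ = 1 - symmetrizer d n := by
  rw [Matrix.conjTranspose_sub, symm_herm, Matrix.conjTranspose_one]

lemma cosymm_psd (d n : ℕ) : (1 - symmetrizer d n).PosSemidef := by
  have := Matrix.posSemidef_conjTranspose_mul_self (1 - symmetrizer d n)
  rwa [cosymm_herm, cosymm_idem] at this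

lemma trace_symm_rho (d n : ℕ) (haar : Measure (UG d)) [IsProbabilityMeasure haar]
    (w : Fin n → Fin d) :
    Matrix.trace (symmetrizer d n * rhoWord d n w haar) =
      ((n.factorial : ℂ))⁻¹ * ∏ i, ((Fintype.card {a // w a = i}).factorial : ℂ) := by
  simp only [Matrix.trace, Matrix.diag_apply, symm_mul_apply]
  rw [← Finset.mul_sum, Finset.sum_comm]
  simp only [rho_perm_sum]
  congr 1
  have := DomMulAct.stabilizer_card w
  rw [Finset.sum_boole, ← Nat.cast_prod, ← this, Fintype.card_subtype]

lemma trace_rho (d n : ℕ) (haar : Measure (UG d)) [IsProbabilityMeasure haar]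
    (w : Fin n → Fin d) : Matrix.trace (rhoWord d n w haar) = 1 := by
  have := rho_perm_sum d n haar w 1
  simpa [Matrix.trace] using this

lemma symm_rho_const (d n : ℕ) (haar : Measure (UG d)) (w : Fin n → Fin d) (k : Fin d)
    (hw : ∀ i, w i = k) :
    symmetrizer d n * rhoWord d n w haar = rhoWord d n w haar := by
  ext x y
  rw [symm_mul_apply]
  have hw' : w = fun _ => k := funext hw
  have : ∀ π : Equiv.Perm (Fin n), rhoWord d n w haar (x ∘ π) y = rhoWord d n w haar x y := by
    intro π
    simp only [rhoWord, Matrix.of_apply]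
    congr 1; ext U; congr 1
    rw [← tpow_comp d n _ x w π, hw']; rfl
  simp only [this, fact_avg]

lemma word_card (d n : ℕ) (μ : Fin d → ℕ) (hsum : ∑ i, μ i = n) (k : Fin d) :
    Fintype.card {a // word d n μ hsum a = k} = μ k := by
  have hl : (wordList d μ).length = n := by rw [wordList_length, hsum]
  have h := Fin.card_filter_univ_eq_vector_get_eq_count k (⟨wordList d μ, hl⟩ : List.Vector _ n)
  have hc : (wordList d μ).count k = μ k := by
    rw [wordList, List.count_flatten, List.map_ofFn, List.sum_ofFn]
    simp [List.count_replicate]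
  rw [Fintype.card_subtype, ← hc]
  rw [show (wordList d μ).count k = List.count k (List.Vector.toList ⟨wordList d μ, hl⟩) from rfl,
    ← h]
  congr 1

lemma trace_symm_rhoNE (d n : ℕ) (haar : Measure (UG d)) [IsProbabilityMeasure haar]
    (μ : Fin d → ℕ) (hsum : ∑ i, μ i = n) :
    Matrix.trace (symmetrizer d n * rhoNE d n μ hsum haar) =
      ((Nat.multinomial Finset.univ μ : ℕ) : ℂ)⁻¹ := by
  rw [rhoNE, trace_symm_rho]
  simp only [word_card]
  have h := Nat.multinomial_spec Finset.univ μ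
  rw [hsum] at h
  have h1 : ((∏ i, ((μ i).factorial : ℂ)) * (Nat.multinomial Finset.univ μ : ℂ)) = n.factorial := by
    rw [← h]; push_cast; rfl
  have h2 : (n.factorial : ℂ) ≠ 0 := by exact_mod_cast n.factorial_ne_zero
  rw [← h1] at h2 ⊢
  have h3 := left_ne_zero_of_mul h2
  rw [mul_inv, mul_comm, ← mul_assoc, mul_inv_cancel₀ h3, one_mul]

lemma word_eq_const (d n : ℕ) (hd : 0 < d) (a : Fin n) :
    word d n (muEq d n hd) (muEq_sum d n hd) a = ⟨0, hd⟩ := by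
  by_contra h
  have h1 := word_card d n (muEq d n hd) (muEq_sum d n hd) (word d n (muEq d n hd) (muEq_sum d n hd) a)
  rw [show muEq d n hd (word d n (muEq d n hd) (muEq_sum d n hd) a) = 0 by
    rw [muEq, if_neg h]] at h1
  rw [Fintype.card_eq_zero_iff] at h1
  exact h1.elim ⟨a, rfl⟩

/-- The type (content) of a word. -/
def ty {d n : ℕ} (x : Fin n → Fin d) : Fin d →₀ ℕ := ∑ i, Finsupp.single (x i) 1

lemma ty_apply {d n : ℕ} (x : Fin n → Fin d) (k : Fin d) :
    ty x k = Fintype.card {a // x a = k} := by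
  rw [Fintype.card_subtype]
  simp [ty, Finsupp.finsetSum_apply, Finsupp.single_apply]

lemma ty_comp {d n : ℕ} (x : Fin n → Fin d) (π : Equiv.Perm (Fin n)) : ty (x ∘ π) = ty x :=
  Equiv.sum_comp π (fun i => Finsupp.single (x i) 1)

lemma ty_perm {d n : ℕ} (x y : Fin n → Fin d) (h : ty x = ty y) :
    ∃ π : Equiv.Perm (Fin n), x = y ∘ π := by
  have e : ∀ c, Nonempty ({a // x a = c} ≃ {b // y b = c}) := fun c => by
    rw [← Fintype.card_eq, ← ty_apply, ← ty_apply, h]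
  refine ⟨Equiv.ofFiberEquiv (fun c => (e c).some), ?_⟩
  ext i
  exact congrArg Fin.val (Equiv.ofFiberEquiv_map (fun c => (e c).some) i).symm

lemma exists_unitary_col (d : ℕ) (k : Fin d) (v : EuclideanSpace ℂ (Fin d)) (hv : ‖v‖ = 1) :
    ∃ U : UG d, ∀ i, (U : Matrix (Fin d) (Fin d) ℂ) i k = v i := by
  have ho : Orthonormal ℂ (({k} : Set (Fin d)).domRestrict (fun _ : Fin d => v)) := by
    constructor
    · intro i; simpa using hv
    · intro i j hij
      exact absurd (Subsingleton.elim i j) hij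
  obtain ⟨b, hb⟩ := ho.exists_orthonormalBasis_extension_of_card_eq (by simp)
  refine ⟨⟨_, OrthonormalBasis.toMatrix_orthonormalBasis_mem_unitary
    (EuclideanSpace.basisFun (Fin d) ℂ) b⟩, fun i => ?_⟩
  simp [Module.Basis.toMatrix_apply, hb k rfl]

lemma key_zero (d n : ℕ) (k : Fin d) (M : Matrix (Fin n → Fin d) (Fin n → Fin d) ℂ)
    (hM : ∀ V : UG d, M * tpow d n (V : Matrix (Fin d) (Fin d) ℂ) =
      tpow d n (V : Matrix (Fin d) (Fin d) ℂ) * M) (x : Fin n → Fin d) (hx : x ≠ fun _ => k) :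
    M x (fun _ => k) = 0 := by
  classical
  set m := (Finset.univ.filter fun i => x i ≠ k).card with hm
  have hm0 : m ≠ 0 := by
    rw [hm, Finset.card_ne_zero]
    obtain ⟨i, hi⟩ := Function.ne_iff.mp hx
    exact ⟨i, by simpa using hi⟩
  set z : ℂ := Complex.exp ((Real.pi / m : ℝ) * Complex.I) with hz
  have hzm : z ^ m = -1 := by
    rw [hz, ← Complex.exp_nat_mul, ← Complex.exp_pi_mul_I]
    congr 1
    have : (m : ℂ) ≠ 0 := by exact_mod_cast hm0
    push_cast
    field_simp
  have hzn : star z * z = 1 := by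
    have h1 : ‖z‖ = 1 := Complex.norm_exp_ofReal_mul_I _
    have := Complex.conj_mul' z
    rw [h1] at this
    simpa using this
  let v : Fin d → ℂ := fun i => if i = k then 1 else z
  have hV : Matrix.diagonal v ∈ Matrix.unitaryGroup (Fin d) ℂ := by
    rw [Matrix.mem_unitaryGroup_iff', Matrix.star_eq_conjTranspose, Matrix.diagonal_conjTranspose,
      Matrix.diagonal_mul_diagonal, ← Matrix.diagonal_one]
    congr 1
    ext i
    simp only [v, Pi.star_apply]
    split_ifs
    · simp
    · exact hzn
  have h := congrFun (congrFun (hM ⟨_, hV⟩) x) (fun _ => k)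
  simp only [tpow_diag, Matrix.mul_diagonal, Matrix.diagonal_mul] at h
  have hp : ∏ i, v (x i) = -1 := by
    simp only [v]
    rw [Finset.prod_ite]
    simp only [Finset.prod_const_one, one_mul, Finset.prod_const]
    exact hzm
  rw [hp] at h
  simp only [v, if_true, Finset.prod_const_one, mul_one, neg_mul, one_mul] at h
  exact self_eq_neg.mp h

lemma key_vec (d n : ℕ) (hn : 1 ≤ n) (k : Fin d)
    (M : Matrix (Fin n → Fin d) (Fin n → Fin d) ℂ)
    (hM : ∀ V : UG d, M * tpow d n (V : Matrix (Fin d) (Fin d) ℂ) =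
      tpow d n (V : Matrix (Fin d) (Fin d) ℂ) * M) (x : Fin n → Fin d) (v : Fin d → ℂ) :
    ∑ y, M x y * ∏ i, v (y i) = M (fun _ => k) (fun _ => k) * ∏ i, v (x i) := by
  by_cases hv : v = 0
  · have : ∀ y : Fin n → Fin d, ∏ i, v (y i) = 0 := fun y =>
      Finset.prod_eq_zero (Finset.mem_univ ⟨0, hn⟩) (by simp [hv])
    simp [this]
  set u : EuclideanSpace ℂ (Fin d) := WithLp.toLp 2 v with hu
  have hu0 : u ≠ 0 := by
    intro h
    apply hv
    ext i
    have := congrArg (fun t : EuclideanSpace ℂ (Fin d) => t i) h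
    simpa [hu] using this
  have hr : (‖u‖ : ℂ) ≠ 0 := by exact_mod_cast norm_ne_zero_iff.mpr hu0
  obtain ⟨U, hU⟩ := exists_unitary_col d k ((‖u‖ : ℂ)⁻¹ • u) (by
    rw [norm_smul, norm_inv, Complex.norm_real, norm_norm]
    exact inv_mul_cancel₀ (norm_ne_zero_iff.mpr hu0))
  have hU' : ∀ i, (U : Matrix (Fin d) (Fin d) ℂ) i k = (‖u‖ : ℂ)⁻¹ * v i := by
    intro i; rw [hU]; simp [hu]
  have h := congrFun (congrFun (hM U) x) (fun _ => k)
  rw [Matrix.mul_apply, Matrix.mul_apply] at h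
  rw [Finset.sum_eq_single_of_mem (s := Finset.univ)
    (f := fun j => tpow d n (U : Matrix (Fin d) (Fin d) ℂ) x j * M j fun _ => k)
    (fun _ => k) (Finset.mem_univ _)
    (fun b _ hb => by rw [key_zero d n k M hM b hb, mul_zero])] at h
  simp only [tpow, Matrix.of_apply, hU', Finset.prod_mul_distrib, Finset.prod_const,
    Finset.card_univ, Fintype.card_fin] at h
  have hr' : ((‖u‖ : ℂ)⁻¹) ^ n ≠ 0 := pow_ne_zero _ (inv_ne_zero hr)
  apply mul_left_cancel₀ hr'
  rw [Finset.mul_sum]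
  calc _ = _ := Finset.sum_congr rfl fun y _ => by ring
    _ = _ := h
    _ = _ := by ring

lemma key_type (d n : ℕ) (hn : 1 ≤ n) (k : Fin d)
    (M : Matrix (Fin n → Fin d) (Fin n → Fin d) ℂ)
    (hM : ∀ V : UG d, M * tpow d n (V : Matrix (Fin d) (Fin d) ℂ) =
      tpow d n (V : Matrix (Fin d) (Fin d) ℂ) * M) (x : Fin n → Fin d) (t : Fin d →₀ ℕ) :
    (∑ y, if ty y = t then M x y else 0) =
      if ty x = t then M (fun _ => k) (fun _ => k) else 0 := by
  have hmono : ∀ (y : Fin n → Fin d) (c : ℂ) (v : Fin d → ℂ),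
      MvPolynomial.eval v (MvPolynomial.monomial (ty y) c) = c * ∏ i, v (y i) := by
    intro y c v
    rw [MvPolynomial.eval_monomial, ty, ← Finsupp.prod_finsetSum_index (by simp) (by simp [pow_add])]
    simp
  have h : (∑ y, MvPolynomial.monomial (ty y) (M x y)) =
      MvPolynomial.monomial (ty x) (M (fun _ => k) (fun _ => k)) := by
    apply MvPolynomial.funext
    intro v
    rw [map_sum]
    simp only [hmono]
    exact key_vec d n hn k M hM x v
  have h2 := congrArg (MvPolynomial.coeff t) h
  rw [MvPolynomial.coeff_sum] at h2
  simpa only [MvPolynomial.coeff_monomial] using h2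

lemma symm_eq_ite (d n : ℕ) (x y : Fin n → Fin d) :
    symmetrizer d n x y = if ty x = ty y then symmetrizer d n y y else 0 := by
  split_ifs with h
  · obtain ⟨π, rfl⟩ := ty_perm x y h
    rw [symm_left]
  · rw [symm_apply, Finset.sum_eq_zero, mul_zero]
    intro π _
    rw [if_neg]
    rintro rfl
    exact h (ty_comp x π).symm

lemma key_mul_symm (d n : ℕ) (hd : 0 < d) (hn : 1 ≤ n)
    (M : Matrix (Fin n → Fin d) (Fin n → Fin d) ℂ)
    (hM : ∀ V : UG d, M * tpow d n (V : Matrix (Fin d) (Fin d) ℂ) =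
      tpow d n (V : Matrix (Fin d) (Fin d) ℂ) * M) :
    ∃ c : ℂ, M * symmetrizer d n = c • symmetrizer d n := by
  refine ⟨M (fun _ => ⟨0, hd⟩) (fun _ => ⟨0, hd⟩), ?_⟩
  ext x y
  rw [Matrix.mul_apply, Matrix.smul_apply, smul_eq_mul, symm_eq_ite d n x y]
  have h := key_type d n hn ⟨0, hd⟩ M hM x (ty y)
  calc ∑ z, M x z * symmetrizer d n z y
      = (∑ z, if ty z = ty y then M x z else 0) * symmetrizer d n y y := by
        rw [Finset.sum_mul]
        refine Finset.sum_congr rfl fun z _ => ?_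
        rw [symm_eq_ite d n z y]
        split_ifs <;> simp
    _ = _ := by
        rw [h]
        split_ifs <;> simp

lemma rho_struct (d n : ℕ) (hd : 0 < d) (hn : 1 ≤ n) (μ : Fin d → ℕ) (hsum : ∑ i, μ i = n)
    (haar : Measure (UG d)) [IsProbabilityMeasure haar]
    (hinv : ∀ V : UG d, Measure.map (fun U => V * U) haar = haar) :
    rhoNE d n μ hsum haar * symmetrizer d n =
      ((Nat.multinomial Finset.univ μ : ℕ) : ℂ)⁻¹ • rhoEQ d n hd haar ∧
    symmetrizer d n * rhoNE d n μ hsum haar =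
      ((Nat.multinomial Finset.univ μ : ℕ) : ℂ)⁻¹ • rhoEQ d n hd haar := by
  obtain ⟨c, hc⟩ := key_mul_symm d n hd hn _
    (rho_comm d n haar hinv (word d n μ hsum))
  obtain ⟨e, he⟩ := key_mul_symm d n hd hn _
    (rho_comm d n haar hinv (word d n _ (muEq_sum d n hd)))
  change rhoNE d n μ hsum haar * _ = _ at hc
  change rhoEQ d n hd haar * _ = _ at he
  have hS : symmetrizer d n * rhoEQ d n hd haar = rhoEQ d n hd haar :=
    symm_rho_const d n haar _ ⟨0, hd⟩ (word_eq_const d n hd)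
  have hH : (rhoEQ d n hd haar)ᴴ = rhoEQ d n hd haar := rho_herm d n haar _
  have hHμ : (rhoNE d n μ hsum haar)ᴴ = rhoNE d n μ hsum haar := rho_herm d n haar _
  have hS' : rhoEQ d n hd haar * symmetrizer d n = rhoEQ d n hd haar := by
    have := congrArg Matrix.conjTranspose hS
    rwa [Matrix.conjTranspose_mul, hH, symm_herm] at this
  rw [hS'] at he
  have ht : e * Matrix.trace (symmetrizer d n) = 1 := by
    have := congrArg Matrix.trace he
    rw [Matrix.trace_smul, smul_eq_mul] at this
    rw [← this]
    exact trace_rho d n haar _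
  have htc : c * Matrix.trace (symmetrizer d n) =
      ((Nat.multinomial Finset.univ μ : ℕ) : ℂ)⁻¹ := by
    have := congrArg Matrix.trace hc
    rw [Matrix.trace_smul, smul_eq_mul, Matrix.trace_mul_comm, trace_symm_rhoNE] at this
    exact this.symm
  have h1 : rhoNE d n μ hsum haar * symmetrizer d n =
      ((Nat.multinomial Finset.univ μ : ℕ) : ℂ)⁻¹ • rhoEQ d n hd haar := by
    rw [hc, he, ← htc, smul_smul]
    congr 1
    linear_combination (-c) * ht
  refine ⟨h1, ?_⟩
  have := congrArg Matrix.conjTranspose h1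
  rw [Matrix.conjTranspose_mul, hHμ, symm_herm, Matrix.conjTranspose_smul, hH] at this
  simpa using this

lemma trace_test (d n : ℕ) (hd : 0 < d) (hn : 1 ≤ n) (μ : Fin d → ℕ) (hsum : ∑ i, μ i = n)
    (haar : Measure (UG d)) [IsProbabilityMeasure haar]
    (hinv : ∀ V : UG d, Measure.map (fun U => V * U) haar = haar) (a t : ℂ) :
    Matrix.trace ((a • symmetrizer d n + t • (1 - symmetrizer d n)) * rhoEQ d n hd haar) = a ∧
    Matrix.trace ((a • symmetrizer d n + t • (1 - symmetrizer d n)) * rhoNE d n μ hsum haar) =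
      a * ((Nat.multinomial Finset.univ μ : ℕ) : ℂ)⁻¹ +
      t * (1 - ((Nat.multinomial Finset.univ μ : ℕ) : ℂ)⁻¹) := by
  have hS : symmetrizer d n * rhoEQ d n hd haar = rhoEQ d n hd haar :=
    symm_rho_const d n haar _ ⟨0, hd⟩ (word_eq_const d n hd)
  have h1 : Matrix.trace (rhoEQ d n hd haar) = 1 := trace_rho d n haar _
  have h2 : Matrix.trace (rhoNE d n μ hsum haar) = 1 := trace_rho d n haar _
  constructor
  · simp [add_mul, sub_mul, hS, h1, Matrix.trace_add, Matrix.trace_smul]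
  · simp only [add_mul, sub_mul, Matrix.smul_mul, Matrix.trace_add, Matrix.trace_smul,
      Matrix.trace_sub, trace_symm_rhoNE, Matrix.one_mul, h2, smul_eq_mul]

lemma povm_test (d n : ℕ) (a t : ℝ) (ha : 0 ≤ a) (ha1 : a ≤ 1) (ht : 0 ≤ t) (ht1 : t ≤ 1) :
    ((a : ℂ) • symmetrizer d n + (t : ℂ) • (1 - symmetrizer d n)) ∈ POVMs d n := by
  have key : ∀ a t : ℝ, 0 ≤ a → 0 ≤ t →
      ((a : ℂ) • symmetrizer d n + (t : ℂ) • (1 - symmetrizer d n)).PosSemidef := by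
    intro a t ha ht
    exact ((symm_psd d n).smul (Complex.zero_le_real.mpr ha)).add
      ((cosymm_psd d n).smul (Complex.zero_le_real.mpr ht))
  refine ⟨key a t ha ht, ?_⟩
  have := key (1 - a) (1 - t) (by linarith) (by linarith)
  convert this using 1
  push_cast
  module

lemma povm_bounds (d n : ℕ) (hd : 0 < d) (hn : 1 ≤ n) (μ : Fin d → ℕ) (hsum : ∑ i, μ i = n)
    (haar : Measure (UG d)) [IsProbabilityMeasure haar]
    (hinv : ∀ V : UG d, Measure.map (fun U => V * U) haar = haar)
    (P : Matrix (Fin n → Fin d) (Fin n → Fin d) ℂ) (hP : P.PosSemidef) :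
    (Matrix.trace (P * rhoEQ d n hd haar)).re * (Nat.multinomial Finset.univ μ : ℝ)⁻¹ ≤
      (Matrix.trace (P * rhoNE d n μ hsum haar)).re := by
  obtain ⟨h1, h2⟩ := rho_struct d n hd hn μ hsum haar hinv
  have hS : symmetrizer d n * rhoEQ d n hd haar = rhoEQ d n hd haar :=
    symm_rho_const d n haar _ ⟨0, hd⟩ (word_eq_const d n hd)
  have hQ := hP.conjTranspose_mul_mul_same (1 - symmetrizer d n)
  rw [cosymm_herm] at hQ
  have h3 := rho_trace_nonneg d n haar (word d n μ hsum) _ hQ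
  change 0 ≤ (Matrix.trace (_ * rhoNE d n μ hsum haar)).re at h3
  have h4 : (1 - symmetrizer d n) * rhoNE d n μ hsum haar * (1 - symmetrizer d n) =
      rhoNE d n μ hsum haar -
        ((Nat.multinomial Finset.univ μ : ℕ) : ℂ)⁻¹ • rhoEQ d n hd haar := by
    have h6 : symmetrizer d n * rhoNE d n μ hsum haar * symmetrizer d n =
        ((Nat.multinomial Finset.univ μ : ℕ) : ℂ)⁻¹ • rhoEQ d n hd haar := by
      rw [Matrix.mul_assoc, h1, Matrix.mul_smul, hS]
    simp only [mul_sub, sub_mul, Matrix.one_mul, Matrix.mul_one]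
    rw [h6, h1, h2]
    abel
  have h5 : Matrix.trace ((1 - symmetrizer d n) * P * (1 - symmetrizer d n) *
      rhoNE d n μ hsum haar) = Matrix.trace (P * rhoNE d n μ hsum haar) -
      ((Nat.multinomial Finset.univ μ : ℕ) : ℂ)⁻¹ * Matrix.trace (P * rhoEQ d n hd haar) := by
    rw [Matrix.mul_assoc, Matrix.mul_assoc, Matrix.trace_mul_comm, Matrix.mul_assoc, h4, mul_sub,
      Matrix.trace_sub, Matrix.mul_smul, Matrix.trace_smul, smul_eq_mul]
  rw [h5, ← Complex.ofReal_natCast, ← Complex.ofReal_inv, Complex.sub_re,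
    Complex.re_ofReal_mul] at h3
  linarith

/-- The achievable hypothesis-testing region is exactly the parallelogram
`{(α,β) ∈ [0,1]² : (1-α)/N ≤ β ≤ 1 - α/N}` with `N = binom(n,μ)`; the lower boundary is
achieved by `(1-α)Π_{(n)}` and the upper boundary by `(1-α)Π_{(n)} + (I - Π_{(n)})`. -/
theorem hypothesis_testing_region (d n : ℕ) (hd : 2 ≤ d) (hn : 1 ≤ n)
    (μ : Fin d → ℕ) (hmono : ∀ i j : Fin d, i ≤ j → μ j ≤ μ i) (hsum : ∑ i, μ i = n)
    (hμ2 : 1 ≤ μ ⟨1, by omega⟩)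
    (haar : Measure (UG d)) [IsProbabilityMeasure haar]
    (hinv : ∀ V : UG d, Measure.map (fun U => V * U) haar = haar) :
    {ab : ℝ × ℝ | ∃ P ∈ POVMs d n,
        ab.1 = 1 - (Matrix.trace (P * rhoEQ d n (by omega) haar)).re ∧
        ab.2 = (Matrix.trace (P * rhoNE d n μ hsum haar)).re}
      = {ab : ℝ × ℝ | 0 ≤ ab.1 ∧ ab.1 ≤ 1 ∧ 0 ≤ ab.2 ∧ ab.2 ≤ 1 ∧
          (1 - ab.1) / (Nat.multinomial Finset.univ μ : ℝ) ≤ ab.2 ∧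
          ab.2 ≤ 1 - ab.1 / (Nat.multinomial Finset.univ μ : ℝ)} ∧
    (∀ α : ℝ, 0 ≤ α → α ≤ 1 →
      ((1 - α : ℂ) • symmetrizer d n ∈ POVMs d n ∧
        1 - (Matrix.trace ((1 - α : ℂ) • symmetrizer d n * rhoEQ d n (by omega) haar)).re = α ∧
        (Matrix.trace ((1 - α : ℂ) • symmetrizer d n * rhoNE d n μ hsum haar)).re
          = (1 - α) / (Nat.multinomial Finset.univ μ : ℝ)) ∧
      ((1 - α : ℂ) • symmetrizer d n + (1 - symmetrizer d n) ∈ POVMs d n ∧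
        1 - (Matrix.trace (((1 - α : ℂ) • symmetrizer d n + (1 - symmetrizer d n)) *
            rhoEQ d n (by omega) haar)).re = α ∧
        (Matrix.trace (((1 - α : ℂ) • symmetrizer d n + (1 - symmetrizer d n)) *
            rhoNE d n μ hsum haar)).re
          = 1 - α / (Nat.multinomial Finset.univ μ : ℝ))) := by
  have hd0 : 0 < d := by omega
  set N : ℝ := (Nat.multinomial Finset.univ μ : ℝ) with hN
  have hNC : ((Nat.multinomial Finset.univ μ : ℕ) : ℂ)⁻¹ = ((N⁻¹ : ℝ) : ℂ) := by
    rw [hN]; push_cast; rfl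
  have hN1 : 1 ≤ N := by
    have : 0 < Nat.multinomial Finset.univ μ := Nat.multinomial_pos _ _
    rw [hN]; exact_mod_cast this
  have hNi : N⁻¹ ≤ 1 := inv_le_one_of_one_le₀ hN1
  have hNp : 0 < N⁻¹ := by positivity
  have hTE : ∀ a t : ℝ, (Matrix.trace (((a : ℂ) • symmetrizer d n +
      (t : ℂ) • (1 - symmetrizer d n)) * rhoEQ d n hd0 haar)).re = a := by
    intro a t
    rw [(trace_test d n hd0 hn μ hsum haar hinv a t).1, Complex.ofReal_re]
  have hTN : ∀ a t : ℝ, (Matrix.trace (((a : ℂ) • symmetrizer d n +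
      (t : ℂ) • (1 - symmetrizer d n)) * rhoNE d n μ hsum haar)).re =
      a * N⁻¹ + t * (1 - N⁻¹) := by
    intro a t
    rw [(trace_test d n hd0 hn μ hsum haar hinv a t).2, hNC, ← Complex.ofReal_one,
      ← Complex.ofReal_sub, ← Complex.ofReal_mul, ← Complex.ofReal_mul, ← Complex.ofReal_add,
      Complex.ofReal_re]
  have e0 : ∀ α : ℝ, (1 - α : ℂ) • symmetrizer d n = ((1 - α : ℝ) : ℂ) • symmetrizer d n +
      ((0 : ℝ) : ℂ) • (1 - symmetrizer d n) := by
    intro α; simp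
  have e1 : ∀ α : ℝ, (1 - α : ℂ) • symmetrizer d n + (1 - symmetrizer d n) =
      ((1 - α : ℝ) : ℂ) • symmetrizer d n + ((1 : ℝ) : ℂ) • (1 - symmetrizer d n) := by
    intro α; simp
  refine ⟨?_, ?_⟩
  · ext ⟨α, β⟩
    simp only [Set.mem_ofPred_eq, div_eq_mul_inv]
    constructor
    · rintro ⟨P, ⟨hP, hP1⟩, hα, hβ⟩
      have b1 := povm_bounds d n hd0 hn μ hsum haar hinv P hP
      have b2 := povm_bounds d n hd0 hn μ hsum haar hinv (1 - P) hP1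
      have b3 := rho_trace_nonneg d n haar (word d n _ (muEq_sum d n hd0)) P hP
      have b4 := rho_trace_nonneg d n haar (word d n _ (muEq_sum d n hd0)) (1 - P) hP1
      have t1 : Matrix.trace (rhoEQ d n hd0 haar) = 1 := trace_rho d n haar _
      have t2 : Matrix.trace (rhoNE d n μ hsum haar) = 1 := trace_rho d n haar _
      change 0 ≤ (Matrix.trace (_ * rhoEQ d n hd0 haar)).re at b3
      change 0 ≤ (Matrix.trace (_ * rhoEQ d n hd0 haar)).re at b4
      rw [sub_mul, Matrix.one_mul, Matrix.trace_sub, t1, Complex.sub_re, Complex.one_re] at b4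
      rw [sub_mul, Matrix.one_mul, Matrix.trace_sub, t1, Complex.sub_re, Complex.one_re,
        sub_mul 1 P, Matrix.one_mul, Matrix.trace_sub, t2, Complex.sub_re, Complex.one_re] at b2
      rw [← hβ, ← hN] at b1 b2
      rw [show (Matrix.trace (P * rhoEQ d n hd0 haar)).re = 1 - α by rw [hα]; ring]
        at b1 b2 b3 b4
      have q1 : 0 ≤ (1 - α) * N⁻¹ := mul_nonneg b3 hNp.le
      have q2 : 0 ≤ α * N⁻¹ := mul_nonneg (by linarith) hNp.le
      have q3 : (1 - (1 - α)) * N⁻¹ = α * N⁻¹ := by ring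
      refine ⟨?_, ?_, ?_, ?_, ?_, ?_⟩ <;> linarith
    · rintro ⟨ha0, ha1, hb0, hb1, hl, hu⟩
      obtain ⟨t, ht0, ht1, ht⟩ : ∃ t : ℝ, 0 ≤ t ∧ t ≤ 1 ∧
          β = (1 - α) * N⁻¹ + t * (1 - N⁻¹) := by
        rcases eq_or_lt_of_le hNi with h | h
        · refine ⟨0, le_rfl, zero_le_one, ?_⟩
          rw [h] at hl hu ⊢
          linarith
        · have h' : 0 < 1 - N⁻¹ := by linarith
          refine ⟨(β - (1 - α) * N⁻¹) / (1 - N⁻¹), ?_, ?_, ?_⟩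
          · exact div_nonneg (by linarith) h'.le
          · rw [div_le_one h']; linarith
          · rw [div_mul_cancel₀ _ h'.ne']; ring
      refine ⟨_, povm_test d n (1 - α) t (by linarith) (by linarith) ht0 ht1, ?_, ?_⟩
      · rw [hTE]; ring
      · rw [hTN]; exact ht
  · intro α h0 h1
    rw [e0 α, ← e0 α, e1 α]
    refine ⟨⟨?_, ?_, ?_⟩, ⟨?_, ?_, ?_⟩⟩
    · rw [e0]; exact povm_test d n _ _ (by linarith) (by linarith) le_rfl zero_le_one
    · rw [e0, hTE]; ring
    · rw [e0, hTN]; ring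
    · exact povm_test d n _ _ (by linarith) (by linarith) zero_le_one le_rfl
    · rw [hTE]; ring
    · rw [hTN]; ring

end
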